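/- Let X be a compact metric space equipped with a Borel probability measure dx, let d ≥ 3 be an integer, and suppose c > 0 is a constant such that for every n ≥ 1 and every n points z₁, …, z_n ∈ X one has 𝐖₁^{1,1}((1/n) ∑_{k=1}^n δ_{z_k}, dx) ≥ c/n^{1/d}. Then for all N₁, N₂ ≥ 1 and all points x₁, …, x_{N₁} and y₁, …, y_{N₂} of X, 𝐖₁^{1,1}((1/(N₁+N₂)) (∑_{i=1}^{N₁} δ_{x_i} − ∑_{j=1}^{N₂} δ_{y_j}), dx) ≥ c/(N₁+N₂)^{1/d} − 2N₂/(N₁+N₂). -/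

import Mathlib

open MeasureTheory Filter Metric
open scoped ENNReal

section Defs

variable {X : Type*} [MeasurableSpace X] [MetricSpace X]

/-- A transference plan (coupling) between `μ` and `ν`: a measure on `X × X`
whose marginals are `μ` and `ν`. -/
def IsCoupling (μ ν : Measure X) (π : Measure (X × X)) : Prop :=
  π.map Prod.fst = μ ∧ π.map Prod.snd = ν

/-- The 1-Wasserstein distance between two (nonnegative) measures of equal mass:
the infimum over couplings of the transport cost. -/
noncomputable def W1 (μ ν : Measure X) : ℝ :=
  sInf { r : ℝ | ∃ π : Measure (X × X), IsCoupling μ ν π ∧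
    r = ∫ p : X × X, dist p.1 p.2 ∂π }

/-- The total variation norm `‖μ - ν‖` of the difference of two finite measures. -/
noncomputable def tvNorm (μ ν : Measure X) : ℝ :=
  ((μ - ν) Set.univ + (ν - μ) Set.univ).toReal

/-- The generalized Wasserstein distance `W₁^{a,b}` between two finite nonnegative
measures, possibly of different total mass (Piccoli–Rossi). -/
noncomputable def genW (a b : ℝ) (μ ν : Measure X) : ℝ :=
  sInf { r : ℝ | ∃ μ' ν' : Measure X, IsFiniteMeasure μ' ∧ IsFiniteMeasure ν' ∧
    μ' Set.univ = ν' Set.univ ∧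
    r = a * (tvNorm μ μ' + tvNorm ν ν') + b * W1 μ' ν' }

/-- The signed generalized Wasserstein distance `𝐖₁^{a,b}` between finite signed
measures, defined via the Jordan decompositions. -/
noncomputable def signedW (a b : ℝ) (μ ν : SignedMeasure X) : ℝ :=
  genW a b (μ.toJordanDecomposition.posPart + ν.toJordanDecomposition.negPart)
    (μ.toJordanDecomposition.negPart + ν.toJordanDecomposition.posPart)

/-- The empirical (probability) measure of the first `n` points of a sequence. -/
noncomputable def emp (x : ℕ → X) (n : ℕ) : Measure X :=
  (n : ℝ≥0∞)⁻¹ • ∑ k ∈ Finset.range n, Measure.dirac (x k)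

/-- The (unnormalized) empirical signed measure of the first `n` points of a sequence. -/
noncomputable def sEmp (x : ℕ → X) (n : ℕ) : SignedMeasure X :=
  ∑ k ∈ Finset.range n, (Measure.dirac (x k)).toSignedMeasure

end Defs

namespace MeasureTheory.Measure

variable {X : Type*} [MeasurableSpace X]

lemma add_sub_eq_add_sub (μ ν : Measure X) [IsFiniteMeasure μ] [IsFiniteMeasure ν] :
    μ + (ν - μ) = ν + (μ - ν) := by
  rw [← toSignedMeasure_eq_toSignedMeasure_iff, toSignedMeasure_add, toSignedMeasure_add,
    add_comm ν.toSignedMeasure, ← sub_eq_sub_iff_add_eq_add]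
  exact sub_toSignedMeasure_eq_toSignedMeasure_sub

lemma le_sub_add (μ ν : Measure X) [IsFiniteMeasure μ] [IsFiniteMeasure ν] :
    μ ≤ (μ - ν) + ν := by
  rw [add_comm, ← add_sub_eq_add_sub]
  exact Measure.le_add_right le_rfl

lemma real_mono {μ ν : Measure X} [IsFiniteMeasure ν] (h : μ ≤ ν) (s : Set X) :
    μ.real s ≤ ν.real s :=
  ENNReal.toReal_mono (measure_ne_top ν s) (h s)

lemma toSignedMeasure_sum {ι : Type*} (s : Finset ι) (μ : ι → Measure X)
    [∀ i, IsFiniteMeasure (μ i)] :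
    (∑ i ∈ s, μ i).toSignedMeasure = ∑ i ∈ s, (μ i).toSignedMeasure := by
  classical
  induction s using Finset.induction_on with
  | empty => simp
  | insert a s ha ih =>
    rw [Finset.sum_insert (f := fun i => (μ i).toSignedMeasure) ha, ← ih, ← toSignedMeasure_add]
    exact toSignedMeasure_congr (Finset.sum_insert ha)

end MeasureTheory.Measure

section GenW

variable {X : Type*} [MeasurableSpace X]

lemma tvNorm_eq_measureReal (μ ν : Measure X) [IsFiniteMeasure μ] [IsFiniteMeasure ν] :
    tvNorm μ ν = (μ - ν).real Set.univ + (ν - μ).real Set.univ :=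
  ENNReal.toReal_add (measure_ne_top _ _) (measure_ne_top _ _)

lemma tvNorm_add_left_le (μ τ ν : Measure X) [IsFiniteMeasure μ] [IsFiniteMeasure τ]
    [IsFiniteMeasure ν] : tvNorm (μ + τ) ν ≤ tvNorm μ ν + τ.real Set.univ := by
  have h₁ : μ + τ - ν ≤ (μ - ν) + τ := by
    refine Measure.sub_le_of_le_add ?_
    rw [add_right_comm]
    exact add_le_add_left (Measure.le_sub_add μ ν) τ
  have h₂ : ν - (μ + τ) ≤ ν - μ := by
    refine Measure.sub_le_of_le_add ?_
    rw [← add_assoc]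
    exact Measure.le_add_right (Measure.le_sub_add ν μ)
  have e₁ := Measure.real_mono h₁ Set.univ
  have e₂ := Measure.real_mono h₂ Set.univ
  rw [tvNorm_eq_measureReal, tvNorm_eq_measureReal]
  rw [measureReal_add_apply] at e₁
  linarith

lemma tvNorm_le_tvNorm_add_left (μ τ ν : Measure X) [IsFiniteMeasure μ] [IsFiniteMeasure τ]
    [IsFiniteMeasure ν] : tvNorm μ ν ≤ tvNorm (μ + τ) ν + τ.real Set.univ := by
  have h₁ : μ - ν ≤ μ + τ - ν :=
    Measure.sub_le_of_le_add
      ((Measure.le_add_right le_rfl).trans (Measure.le_sub_add (μ + τ) ν))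
  have h₂ : ν - μ ≤ (ν - (μ + τ)) + τ := by
    refine Measure.sub_le_of_le_add ?_
    rw [add_assoc, add_comm τ]
    exact Measure.le_sub_add ν (μ + τ)
  have e₁ := Measure.real_mono h₁ Set.univ
  have e₂ := Measure.real_mono h₂ Set.univ
  rw [tvNorm_eq_measureReal, tvNorm_eq_measureReal]
  rw [measureReal_add_apply] at e₂
  linarith

variable [MetricSpace X]

lemma W1_nonneg (μ ν : Measure X) : 0 ≤ W1 μ ν := by
  refine Real.sInf_nonneg ?_
  rintro r ⟨π, -, rfl⟩
  exact integral_nonneg fun _ => dist_nonneg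

/-- Moving mass `τ` into the first argument and mass `σ` out of the second one increases the
generalized Wasserstein distance by at most the masses moved. -/
lemma genW_add_left_le (μ τ σ ν : Measure X) [IsFiniteMeasure μ] [IsFiniteMeasure τ]
    [IsFiniteMeasure σ] [IsFiniteMeasure ν] :
    genW 1 1 (μ + τ) ν ≤ genW 1 1 μ (σ + ν) + (τ.real Set.univ + σ.real Set.univ) := by
  rw [← sub_le_iff_le_add]
  refine le_csInf ⟨_, 0, 0, inferInstance, inferInstance, rfl, rfl⟩ ?_
  rintro r ⟨μ', ν', hμ', hν', hmass, rfl⟩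
  rw [sub_le_iff_le_add]
  have hbdd : BddBelow { r : ℝ | ∃ μ' ν' : Measure X, IsFiniteMeasure μ' ∧ IsFiniteMeasure ν' ∧
      μ' Set.univ = ν' Set.univ ∧
      r = 1 * (tvNorm (μ + τ) μ' + tvNorm ν ν') + 1 * W1 μ' ν' } := by
    refine ⟨0, ?_⟩
    rintro r ⟨μ', ν', -, -, -, rfl⟩
    have := W1_nonneg μ' ν'
    unfold tvNorm
    positivity
  refine (csInf_le hbdd ⟨μ', ν', hμ', hν', hmass, rfl⟩).trans ?_
  have h₁ := tvNorm_add_left_le μ τ μ'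
  have h₂ := tvNorm_le_tvNorm_add_left ν σ ν'
  rw [add_comm ν σ] at h₂
  linarith

lemma signedW_sub_toSignedMeasure (α β ν : Measure X) [IsFiniteMeasure α] [IsFiniteMeasure β]
    [IsFiniteMeasure ν] :
    signedW 1 1 (α.toSignedMeasure - β.toSignedMeasure) ν.toSignedMeasure =
      genW 1 1 (α - β) ((β - α) + ν) := by
  have hν : ν.toSignedMeasure = ν.toSignedMeasure - (0 : Measure X).toSignedMeasure := by simp
  rw [hν, signedW, Measure.toJordanDecomposition_toSignedMeasure_sub,
    Measure.toJordanDecomposition_toSignedMeasure_sub]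
  simp [Measure.jordanDecompositionOfToSignedMeasureSub]

lemma signedW_toSignedMeasure (α ν : Measure X) [IsFiniteMeasure α] [IsFiniteMeasure ν] :
    signedW 1 1 α.toSignedMeasure ν.toSignedMeasure = genW 1 1 α ν := by
  simpa using signedW_sub_toSignedMeasure α 0 ν

lemma signedW_add_le_signedW_sub (α β ν : Measure X) [IsFiniteMeasure α] [IsFiniteMeasure β]
    [IsFiniteMeasure ν] :
    signedW 1 1 (α.toSignedMeasure + β.toSignedMeasure) ν.toSignedMeasure ≤
      signedW 1 1 (α.toSignedMeasure - β.toSignedMeasure) ν.toSignedMeasure +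
        2 * β.real Set.univ := by
  rw [← Measure.toSignedMeasure_add, signedW_toSignedMeasure, signedW_sub_toSignedMeasure]
  set ρ := α - (α - β)
  have hα : α = (α - β) + ρ := by
    rw [add_comm]
    exact (Measure.sub_add_cancel_of_le Measure.sub_le).symm
  have hαβ : α + β = (α - β) + (ρ + β) := by
    rw [← add_assoc, ← hα]
  have m₁ := congrArg (fun μ : Measure X => μ.real Set.univ) (Measure.add_sub_eq_add_sub α β)
  have m₂ := congrArg (fun μ : Measure X => μ.real Set.univ) hα
  have hle := genW_add_left_le (α - β) (ρ + β) (β - α) ν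
  rw [← hαβ] at hle
  beta_reduce at m₁ m₂
  rw [measureReal_add_apply, measureReal_add_apply] at m₁
  rw [measureReal_add_apply] at m₂ hle
  linarith

end GenW

/-- If every empirical measure of `n` points satisfies the lower bound
`𝐖₁^{1,1} ≥ c/n^{1/d}`, then
`𝐖₁^{1,1}((1/(N₁+N₂))(∑δ_x − ∑δ_y), dx) ≥ c/(N₁+N₂)^{1/d} − 2N₂/(N₁+N₂)`. -/
theorem signedW_lower_bound {X : Type*} [MeasurableSpace X] [MetricSpace X]
    [BorelSpace X] [CompactSpace X] (dx : Measure X) [IsProbabilityMeasure dx]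
    (d : ℕ) (hd : 3 ≤ d) (c : ℝ) (hc : 0 < c)
    (hlow : ∀ n : ℕ, 1 ≤ n → ∀ z : Fin n → X,
      c / ((n : ℝ) ^ ((1 : ℝ) / d)) ≤
        signedW 1 1 (((n : ℝ))⁻¹ • ∑ k : Fin n, (Measure.dirac (z k)).toSignedMeasure)
          dx.toSignedMeasure) :
    ∀ (N₁ N₂ : ℕ), 1 ≤ N₁ → 1 ≤ N₂ → ∀ (x : Fin N₁ → X) (y : Fin N₂ → X),
      c / (((N₁ + N₂ : ℕ) : ℝ) ^ ((1 : ℝ) / d)) - 2 * (N₂ : ℝ) / ((N₁ : ℝ) + N₂) ≤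
        signedW 1 1
          (((N₁ + N₂ : ℕ) : ℝ)⁻¹ •
            (∑ i : Fin N₁, (Measure.dirac (x i)).toSignedMeasure
              - ∑ j : Fin N₂, (Measure.dirac (y j)).toSignedMeasure))
          dx.toSignedMeasure := by
  intro N₁ N₂ h₁ _ x y
  set r : NNReal := ((N₁ + N₂ : ℕ) : NNReal)⁻¹ with hr
  have hrc : (((N₁ + N₂ : ℕ) : ℝ))⁻¹ = (r : ℝ) := by simp [hr]
  set α : Measure X := r • ∑ i, Measure.dirac (x i)
  set β : Measure X := r • ∑ j, Measure.dirac (y j) with hβ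
  have eα : α.toSignedMeasure = (r : ℝ) • ∑ i, (Measure.dirac (x i)).toSignedMeasure := by
    rw [← Measure.toSignedMeasure_sum]
    exact Measure.toSignedMeasure_smul _ r
  have eβ : β.toSignedMeasure = (r : ℝ) • ∑ j, (Measure.dirac (y j)).toSignedMeasure := by
    rw [← Measure.toSignedMeasure_sum]
    exact Measure.toSignedMeasure_smul _ r
  have hmass : β.real Set.univ = (N₂ : ℝ) / ((N₁ : ℝ) + N₂) := by
    rw [hβ, measureReal_nnreal_smul_apply, measureReal_def]
    simp [hr, Measure.finsetSum_apply, div_eq_inv_mul]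
  have hz := hlow (N₁ + N₂) (by lia) (Fin.append x y)
  simp only [Fin.sum_univ_add, Fin.append_left, Fin.append_right] at hz
  rw [hrc, smul_add, ← eα, ← eβ] at hz
  have hle := hz.trans (signedW_add_le_signedW_sub α β dx)
  rw [hmass] at hle
  rw [hrc, smul_sub, ← eα, ← eβ, mul_div_assoc]
  linarith
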